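/- arXiv:1004.4012 — 2 statements merged into one kernel-verified Lean document; each statement's English description precedes it below -/
import Mathlib

section
/- Let P(x) = x_1^2 + x_2^2 ∈ F_q[x_1,x_2]. There exist absolute constants C > 0 and c > 0 such that for every finite field F_q of odd characteristic and every set E ⊆ F_q^2 with |E| ≥ C q^{4/3}, the distance set satisfies |Δ_P(E,E)| ≥ c q. -/
open Finset

namespace CEHIK

def dt {K : Type} [Field K] (a b : Fin 2 → K) : K := a 0 * b 0 + a 1 * b 1
def nm {K : Type} [Field K] (a : Fin 2 → K) : K := a 0 ^ 2 + a 1 ^ 2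

/-- abstract Plancherel -/
lemma plancherel {A B : Type} [Fintype A] [Fintype B] [DecidableEq A] (k : A → B → ℂ) (Q : ℝ)
    (hk : ∀ a a', ∑ b, k a b * (starRingEnd ℂ) (k a' b) = if a = a' then (Q : ℂ) else 0)
    (f : A → ℂ) : ∑ b, ‖∑ a, f a * k a b‖ ^ 2 = Q * ∑ a, ‖f a‖ ^ 2 := by
  have h : ((∑ b, ‖∑ a, f a * k a b‖ ^ 2 : ℝ) : ℂ) = ((Q * ∑ a, ‖f a‖ ^ 2 : ℝ) : ℂ) := by
    push_cast
    simp_rw [← Complex.mul_conj', map_sum, map_mul, sum_mul_sum]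
    rw [sum_comm]
    simp_rw [sum_comm (s := (univ : Finset B))]
    have : ∀ a a', ∑ b, f a * k a b * ((starRingEnd ℂ) (f a') * (starRingEnd ℂ) (k a' b))
        = f a * (starRingEnd ℂ) (f a') * (if a = a' then (Q : ℂ) else 0) := by
      intro a a'
      rw [← hk, mul_sum]
      exact sum_congr rfl fun b _ => by ring
    simp_rw [this]
    simp [mul_sum, mul_comm]
  exact_mod_cast h

section
variable {K : Type} [Field K] [Fintype K] [DecidableEq K] {ψ : AddChar K ℂ}

lemma sum_two (f : (Fin 2 → K) → ℂ) : ∑ z, f z = ∑ x : K, ∑ y : K, f ![x, y] := by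
  rw [← (finTwoArrowEquiv K).symm.sum_comp, Fintype.sum_prod_type]
  simp

lemma sum_two_mul (f g : K → ℂ) : ∑ z : Fin 2 → K, f (z 0) * g (z 1) = (∑ x, f x) * ∑ y, g y := by
  rw [sum_two, sum_mul_sum]; simp

lemma orth1 (hψ : ψ.IsPrimitive) (a a' : K) :
    ∑ b, ψ (b * a) * (starRingEnd ℂ) (ψ (b * a')) = if a = a' then (((Fintype.card K : ℝ)) : ℂ) else 0 := by
  have := AddChar.sum_mulShift (a - a') hψ
  simp_rw [sub_eq_zero] at this
  simp only [Complex.ofReal_natCast]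
  rw [← Nat.cast_zero (R := ℂ), ← Nat.cast_ite, ← this]
  refine sum_congr rfl fun b _ => ?_
  rw [← AddChar.map_neg_eq_conj, ← AddChar.map_add_eq_mul]; ring_nf

lemma orth2 (hψ : ψ.IsPrimitive) (a a' : Fin 2 → K) :
    ∑ b, ψ (dt b a) * (starRingEnd ℂ) (ψ (dt b a')) = if a = a' then (((Fintype.card K : ℝ) ^ 2 : ℝ) : ℂ) else 0 := by
  have h : ∀ b, ψ (dt b a) * (starRingEnd ℂ) (ψ (dt b a')) =
    (ψ (b 0 * a 0) * (starRingEnd ℂ) (ψ (b 0 * a' 0))) * (ψ (b 1 * a 1) * (starRingEnd ℂ) (ψ (b 1 * a' 1))) := by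
    intro b
    simp only [dt, AddChar.map_add_eq_mul, map_mul]; ring
  simp_rw [h]
  rw [sum_two_mul (fun x => ψ (x * a 0) * (starRingEnd ℂ) (ψ (x * a' 0))) (fun x => ψ (x * a 1) * (starRingEnd ℂ) (ψ (x * a' 1))), orth1 hψ, orth1 hψ]
  have : a = a' ↔ a 0 = a' 0 ∧ a 1 = a' 1 := by
    rw [funext_iff, Fin.forall_fin_two]
  by_cases h0 : a 0 = a' 0 <;> by_cases h1 : a 1 = a' 1 <;> simp [this, h0, h1, sq]

/-- sign -/
noncomputable def eps (K : Type) [Field K] [Fintype K] [DecidableEq K] : ℤ := quadraticChar K (-1)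

lemma eps_cases : eps K = 1 ∨ eps K = -1 := by
  unfold eps
  exact quadraticChar_dichotomy (by simp)

lemma gauss1 (hK : ringChar K ≠ 2) (hψ : ψ.IsPrimitive) (s : K) (hs : s ≠ 0) :
    (∑ x, ψ (s * x ^ 2)) ^ 2 = (eps K : ℂ) * Fintype.card K := by
  set η : MulChar K ℂ := (quadraticChar K).ringHomComp (Int.castRingHom ℂ) with hη
  have hη1 : η ≠ 1 := by
    rw [hη, Ne, MulChar.ringHomComp_eq_one_iff (RingHom.injective_int _)]
    exact quadraticChar_ne_one hK
  have hη2 : η.IsQuadratic := (quadraticChar_isQuadratic K).comp _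
  have h1 : ∑ x, ψ (s * x ^ 2) = gaussSum η (ψ.mulShift s) := by
    have : ∑ x, ψ (s * x ^ 2) = ∑ a, ∑ x with x ^ 2 = a, ψ (s * a) := by
      rw [← sum_fiberwise univ (fun x : K => x ^ 2)]
      refine sum_congr rfl fun a _ => sum_congr rfl fun x hx => ?_
      rw [(mem_filter.1 hx).2]
    rw [this]
    have h2 : ∀ a : K, ∑ x with x ^ 2 = a, ψ (s * a) = η a * ψ (s * a) + ψ (a * s) := by
      intro a
      have := quadraticChar_card_sqrts hK a
      rw [sum_const, nsmul_eq_mul]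
      have h3 : (#{x : K | x ^ 2 = a} : ℂ) = η a + 1 := by
        have h4 : ((#{x : K | x ^ 2 = a} : ℤ)) = quadraticChar K a + 1 := by
          rw [← this]; congr 2; ext; simp
        have := congrArg (Int.cast : ℤ → ℂ) h4
        simpa [hη] using this
      rw [h3, mul_comm a s]; ring
    simp_rw [h2]
    rw [sum_add_distrib, AddChar.sum_mulShift s hψ, if_neg hs]
    simp [gaussSum, AddChar.mulShift_apply]
  rw [h1]
  have h3 : (ψ.mulShift s).IsPrimitive := by
    apply AddChar.IsPrimitive.of_ne_one
    exact hψ hs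
  rw [gaussSum_sq hη1 hη2 h3]
  simp [hη, eps]

lemma gauss2 (hK : ringChar K ≠ 2) (hψ : ψ.IsPrimitive) (r : K) (hr : r ≠ 0) (v : Fin 2 → K) :
    ∑ z, ψ (dt z v) * ψ (r * nm z) = (eps K : ℂ) * Fintype.card K * ψ (-(4 * r)⁻¹ * nm v) := by
  have h2 : (2 : K) ≠ 0 := Ring.two_ne_zero hK
  have key : ∀ c : K, ∑ x, ψ (x * c + r * x ^ 2) = ψ (-(4 * r)⁻¹ * c ^ 2) * ∑ x, ψ (r * x ^ 2) := by
    intro c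
    rw [← Equiv.sum_comp (Equiv.addRight (c / (2 * r))) (fun x => ψ (r * x ^ 2)), mul_sum]
    refine sum_congr rfl fun x _ => ?_
    rw [← AddChar.map_add_eq_mul]
    congr 1
    have h4 : (4 : K) = 2 * 2 := by norm_num
    rw [h4]
    simp only [Equiv.coe_addRight]
    field_simp
    ring
  have h : ∀ z, ψ (dt z v) * ψ (r * nm z) = ψ (z 0 * v 0 + r * z 0 ^ 2) * ψ (z 1 * v 1 + r * z 1 ^ 2) := by
    intro z
    rw [← AddChar.map_add_eq_mul, ← AddChar.map_add_eq_mul]; congr 1; simp only [dt, nm]; ring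
  simp_rw [h]
  rw [sum_two_mul (fun x => ψ (x * v 0 + r * x ^ 2)) (fun x => ψ (x * v 1 + r * x ^ 2)), key, key,
    ← gauss1 hK hψ r hr]
  simp only [nm, mul_add, AddChar.map_add_eq_mul]; ring

/-- circle intersection -/
lemma circ (hK : ringChar K ≠ 2) (t : K) (ht : t ≠ 0) (η : Fin 2 → K) (hη : η ≠ 0) :
    #{ξ : Fin 2 → K | nm ξ = t ∧ nm (η - ξ) = t} ≤ 2 := by
  have h2 : (2 : K) ≠ 0 := Ring.two_ne_zero hK
  rcases (univ.filter fun ξ : Fin 2 → K => nm ξ = t ∧ nm (η - ξ) = t).eq_empty_or_nonempty with h | ⟨ξ, hξ⟩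
  · simp [h]
  refine (card_le_card (t := {ξ, η - ξ}) ?_).trans card_le_two
  intro ζ hζ
  replace hξ := (mem_filter.1 hξ).2
  replace hζ := (mem_filter.1 hζ).2
  simp only [nm, Pi.sub_apply] at hξ hζ
  obtain ⟨a, b, hab⟩ : ∃ a b, η = ![a, b] := ⟨η 0, η 1, by ext i; fin_cases i <;> rfl⟩
  obtain ⟨x, y, hxy⟩ : ∃ a b, ξ = ![a, b] := ⟨ξ 0, ξ 1, by ext i; fin_cases i <;> rfl⟩
  obtain ⟨u, v, huv⟩ : ∃ a b, ζ = ![a, b] := ⟨ζ 0, ζ 1, by ext i; fin_cases i <;> rfl⟩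
  subst hab hxy huv
  simp only [Matrix.cons_val_zero, Matrix.cons_val_one, Matrix.cons_val_fin_one] at hξ hζ
  obtain ⟨e1, e2⟩ := hξ
  obtain ⟨f1, f2⟩ := hζ
  have l1 : 2 * (a * x + b * y) = a ^ 2 + b ^ 2 := by linear_combination e1 - e2
  have l2 : 2 * (a * u + b * v) = a ^ 2 + b ^ 2 := by linear_combination f1 - f2
  have l3 : a * (x - u) + b * (y - v) = 0 := by
    apply mul_left_cancel₀ h2; linear_combination l1 - l2
  have hn : a ^ 2 + b ^ 2 ≠ 0 := by
    intro hn
    rw [hn] at l1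
    have l4 : a * x + b * y = 0 := by
      apply mul_left_cancel₀ h2; rw [l1]; ring
    have ha : a ^ 2 * t = 0 := by
      linear_combination (-a^2) * e1 + (a * x - b * y) * l4 + y ^ 2 * hn
    have ha : a = 0 := by simpa [ht] using ha
    have hb : b = 0 := by simpa [ha] using hn
    exact hη (by ext i; fin_cases i <;> simp [ha, hb])
  have hw : (a * y - b * x - (a * v - b * u)) * (a * y - b * x + (a * v - b * u)) = 0 := by
    have l5 : a * x + b * y = a * u + b * v := by linear_combination l3
    linear_combination (a^2+b^2) * (e1 - f1) - (a * x + b * y + (a * u + b * v)) * l5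
  simp only [mem_insert, mem_singleton]
  rcases mul_eq_zero.1 hw with h | h
  · left
    have hx : u = x := by
      apply mul_left_cancel₀ hn; linear_combination (-a) * l3 + b * h
    have hy : v = y := by
      apply mul_left_cancel₀ hn; linear_combination (-b) * l3 - a * h
    rw [hx, hy]
  · right
    have hx : u = a - x := by
      apply mul_left_cancel₀ hn
      apply mul_left_cancel₀ h2
      linear_combination a * l1 + a * l2 - 2 * b * h
    have hy : v = b - y := by
      apply mul_left_cancel₀ hn
      apply mul_left_cancel₀ h2
      linear_combination b * l1 + b * l2 + 2 * a * h
    ext i; fin_cases i <;> simp [hx, hy]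

end

section
variable {K : Type} [Field K] [Fintype K] [DecidableEq K]

noncomputable def Fh (ψ : AddChar K ℂ) (E : Finset (Fin 2 → K)) (ξ : Fin 2 → K) : ℂ :=
  ∑ x ∈ E, ψ (dt ξ x)

noncomputable def nu (E : Finset (Fin 2 → K)) (t : K) : ℝ :=
  (#{p ∈ E ×ˢ E | nm (p.1 - p.2) = t} : ℝ)

noncomputable def sg (ψ : AddChar K ℂ) (E : Finset (Fin 2 → K)) (t : K) : ℝ :=
  ∑ ξ with nm ξ = t, ‖Fh ψ E ξ‖ ^ 2

variable {ψ : AddChar K ℂ} (E : Finset (Fin 2 → K))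

lemma planch2 (hψ : ψ.IsPrimitive) (f : (Fin 2 → K) → ℂ) :
    ∑ ξ, ‖∑ x, f x * ψ (dt ξ x)‖ ^ 2 = (Fintype.card K : ℝ) ^ 2 * ∑ x, ‖f x‖ ^ 2 :=
  plancherel (fun a b => ψ (dt b a)) _ (orth2 hψ) f

lemma planch1 (hψ : ψ.IsPrimitive) (f : K → ℝ) :
    ∑ s, ‖∑ t, (f t : ℂ) * ψ (s * t)‖ ^ 2 = (Fintype.card K : ℝ) * ∑ t, f t ^ 2 := by
  rw [plancherel (fun a b => ψ (b * a)) _ (orth1 hψ) (fun t => (f t : ℂ))]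
  simp

lemma sumchar (hψ : ψ.IsPrimitive) (f : K → ℝ) :
    ∑ s, ∑ t, (f t : ℂ) * ψ (s * t) = (Fintype.card K : ℂ) * f 0 := by
  rw [sum_comm]
  simp_rw [← mul_sum, AddChar.sum_mulShift _ hψ]
  simp [mul_comm]

lemma sum_sg (hψ : ψ.IsPrimitive) : ∑ t, sg ψ E t = (Fintype.card K : ℝ) ^ 2 * #E := by
  have h := planch2 hψ (fun x => if x ∈ E then 1 else 0)
  simp only [sg]
  rw [sum_fiberwise univ (fun ξ => nm ξ) (fun ξ => ‖Fh ψ E ξ‖ ^ 2)]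
  have e1 : ∀ ξ, Fh ψ E ξ = ∑ x, (if x ∈ E then (1 : ℂ) else 0) * ψ (dt ξ x) := by
    intro ξ; simp [Fh]
  simp_rw [e1, h]
  congr 1
  have : ∀ x, ‖(if x ∈ E then (1 : ℂ) else 0)‖ ^ 2 = if x ∈ E then (1 : ℝ) else 0 := by
    intro x; split_ifs <;> simp
  simp_rw [this]; simp

lemma sum_nu : ∑ t, nu E t = (#E : ℝ) ^ 2 := by
  simp only [nu]
  rw [← Nat.cast_sum, ← card_eq_sum_card_fiberwise (fun _ _ => by simp), card_product]
  push_cast; ring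

lemma W_eq (r : K) : ∑ t, (sg ψ E t : ℂ) * ψ (r * t) =
    ∑ ξ, ((‖Fh ψ E ξ‖ ^ 2 : ℝ) : ℂ) * ψ (r * nm ξ) := by
  rw [← sum_fiberwise univ (fun ξ => nm ξ)]
  refine sum_congr rfl fun t _ => ?_
  simp only [sg]
  rw [Complex.ofReal_sum, sum_mul]
  refine sum_congr rfl fun ξ hξ => ?_
  rw [(mem_filter.1 hξ).2]

lemma V_eq (s : K) : ∑ t, (nu E t : ℂ) * ψ (s * t) =
    ∑ p ∈ E ×ˢ E, ψ (s * nm (p.1 - p.2)) := by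
  rw [← sum_fiberwise (E ×ˢ E) (fun p => nm (p.1 - p.2))]
  refine sum_congr rfl fun t _ => ?_
  simp only [nu]
  rw [Complex.ofReal_natCast, ← nsmul_eq_mul, ← sum_const]
  refine sum_congr rfl fun ξ hξ => ?_
  rw [(mem_filter.1 hξ).2]

lemma WV (hK : ringChar K ≠ 2) (hψ : ψ.IsPrimitive) (r : K) (hr : r ≠ 0) :
    ∑ t, (sg ψ E t : ℂ) * ψ (r * t) =
    (eps K : ℂ) * Fintype.card K * ∑ t, (nu E t : ℂ) * ψ (-(4 * r)⁻¹ * t) := by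
  rw [W_eq, V_eq, mul_sum]
  simp_rw [← gauss2 hK hψ r hr]
  rw [sum_comm]
  refine sum_congr rfl fun ξ _ => ?_
  rw [← sum_mul, sum_product]
  congr 1
  push_cast
  rw [← Complex.mul_conj']
  simp only [Fh]
  rw [map_sum, sum_mul_sum]
  refine sum_congr rfl fun x _ => sum_congr rfl fun y _ => ?_
  rw [← AddChar.map_neg_eq_conj, ← AddChar.map_add_eq_mul]
  congr 1
  simp only [dt, Pi.sub_apply]; ring

lemma four_ne (hK : ringChar K ≠ 2) : (4 : K) ≠ 0 := by
  have h2 : (2 : K) ≠ 0 := Ring.two_ne_zero hK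
  have h4 : (4 : K) = 2 * 2 := by norm_num
  rw [h4]; exact mul_ne_zero h2 h2

/-- reparametrise nonzero elements -/
lemma reparam {M : Type} [AddCommMonoid M] (hK : ringChar K ≠ 2) (f : K → M) :
    ∑ r ∈ univ.erase (0 : K), f (-(4 * r)⁻¹) = ∑ s ∈ univ.erase (0 : K), f s := by
  have h4 := four_ne hK
  refine sum_nbij' (fun r => -(4 * r)⁻¹) (fun r => -(4 * r)⁻¹) ?_ ?_ ?_ ?_ ?_
  · intro a ha; simp_all
  · intro a ha; simp_all
  · intro a ha
    have : a ≠ 0 := by simpa using ha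
    field_simp
  · intro a ha
    have : a ≠ 0 := by simpa using ha
    field_simp
  · intro a ha; rfl

lemma id_sq (hK : ringChar K ≠ 2) (hψ : ψ.IsPrimitive) :
    (Fintype.card K : ℝ) * ∑ t, sg ψ E t ^ 2 = ((Fintype.card K : ℝ) ^ 2 * #E) ^ 2 +
      (Fintype.card K : ℝ) ^ 2 * ((Fintype.card K : ℝ) * ∑ t, nu E t ^ 2 - (#E : ℝ) ^ 4) := by
  rw [← planch1 hψ, ← planch1 hψ, ← add_sum_erase _ _ (mem_univ (0 : K)),
    ← add_sum_erase _ (fun s => ‖∑ t, (nu E t : ℂ) * ψ (s * t)‖ ^ 2) (mem_univ (0 : K)),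
    ← reparam hK (fun s => ‖∑ t, (nu E t : ℂ) * ψ (s * t)‖ ^ 2)]
  have hs : ‖∑ t, (sg ψ E t : ℂ) * ψ (0 * t)‖ ^ 2 = ((Fintype.card K : ℝ) ^ 2 * #E) ^ 2 := by
    rw [← sum_sg E hψ]; simp only [zero_mul, AddChar.map_zero_eq_one, mul_one]
    rw [← Complex.ofReal_sum, Complex.norm_real, Real.norm_eq_abs, sq_abs]
  have hn : ‖∑ t, (nu E t : ℂ) * ψ (0 * t)‖ ^ 2 = (#E : ℝ) ^ 4 := by
    simp only [zero_mul, AddChar.map_zero_eq_one, mul_one]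
    rw [← Complex.ofReal_sum, sum_nu, Complex.norm_real, Real.norm_eq_abs, sq_abs]; ring
  rw [hs, hn, add_sub_cancel_left, mul_sum]
  congr 1
  refine sum_congr rfl fun r hr => ?_
  rw [WV E hK hψ r (by simpa using hr), norm_mul, norm_mul, mul_pow, mul_pow]
  rcases eps_cases (K := K) with h | h <;> simp [h]

lemma id_zero (hK : ringChar K ≠ 2) (hψ : ψ.IsPrimitive) :
    (Fintype.card K : ℝ) * sg ψ E 0 = (Fintype.card K : ℝ) ^ 2 * #E +
      (eps K : ℝ) * (Fintype.card K : ℝ) * ((Fintype.card K : ℝ) * nu E 0 - (#E : ℝ) ^ 2) := by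
  have h : ((Fintype.card K : ℂ)) * sg ψ E 0 = (Fintype.card K : ℂ) ^ 2 * #E +
      (eps K : ℂ) * (Fintype.card K : ℂ) * ((Fintype.card K : ℂ) * nu E 0 - (#E : ℂ) ^ 2) := by
    rw [← sumchar hψ, ← sumchar hψ, ← add_sum_erase _ _ (mem_univ (0 : K)),
      ← add_sum_erase _ (fun s => ∑ t, (nu E t : ℂ) * ψ (s * t)) (mem_univ (0 : K)),
      ← reparam hK (fun s => ∑ t, (nu E t : ℂ) * ψ (s * t))]
    have hs : ∑ t, (sg ψ E t : ℂ) * ψ (0 * t) = (Fintype.card K : ℂ) ^ 2 * #E := by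
      simp only [zero_mul, AddChar.map_zero_eq_one, mul_one]
      rw [← Complex.ofReal_sum, sum_sg E hψ]; push_cast; rfl
    have hn : ∑ t, (nu E t : ℂ) * ψ (0 * t) = (#E : ℂ) ^ 2 := by
      simp only [zero_mul, AddChar.map_zero_eq_one, mul_one]
      rw [← Complex.ofReal_sum, sum_nu]; push_cast; rfl
    rw [hs, hn, add_sub_cancel_left, mul_sum]
    congr 1
    refine sum_congr rfl fun r hr => ?_
    rw [WV E hK hψ r (by simpa using hr)]
  exact_mod_cast h

/-- L4 bound -/
lemma l4 (hK : ringChar K ≠ 2) (hψ : ψ.IsPrimitive) (t : K) (ht : t ≠ 0) :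
    sg ψ E t ^ 4 ≤ (#E : ℝ) ^ 3 * (3 * (Fintype.card K : ℝ) ^ 2 * sg ψ E t ^ 2) := by
  set σ := sg ψ E t with hσ
  set F : (Fin 2 → K) → ℂ := fun ξ => if nm ξ = t then (starRingEnd ℂ) (Fh ψ E ξ) else 0 with hF
  have hFσ : ∑ ξ, ‖F ξ‖ ^ 2 = σ := by
    simp only [hσ, sg, hF, sum_filter]
    refine sum_congr rfl fun ξ _ => ?_
    split_ifs <;> simp
  set H : (Fin 2 → K) → ℂ := fun x => ∑ ξ, F ξ * ψ (dt x ξ) with hH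
  set cv : (Fin 2 → K) → ℂ := fun η => ∑ ξ, F ξ * F (η - ξ) with hcv
  have hσ0 : 0 ≤ σ := sum_nonneg fun _ _ => by positivity
  -- σ as sum over E
  have h1 : (σ : ℂ) = ∑ x ∈ E, H x := by
    simp only [hH]
    rw [sum_comm, hσ, sg, Complex.ofReal_sum, sum_filter]
    refine sum_congr rfl fun ξ _ => ?_
    simp only [hF]
    split_ifs
    · push_cast
      rw [← Complex.conj_mul', ← mul_sum, Fh]
      congr 1
      refine sum_congr rfl fun x _ => ?_
      simp only [dt]; congr 1; ring
    · simp
  have h2 : σ ≤ ∑ x ∈ E, ‖H x‖ := by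
    have := norm_sum_le E H
    rw [← h1, Complex.norm_real, Real.norm_eq_abs, abs_of_nonneg hσ0] at this
    exact this
  have h3 : σ ^ 2 ≤ #E * ∑ x ∈ E, ‖H x‖ ^ 2 :=
    (pow_le_pow_left₀ hσ0 h2 2).trans sq_sum_le_card_mul_sum_sq
  have h4 : (∑ x ∈ E, ‖H x‖ ^ 2) ^ 2 ≤ #E * ∑ x ∈ E, (‖H x‖ ^ 2) ^ 2 := sq_sum_le_card_mul_sum_sq
  have hHsq : ∀ x, H x ^ 2 = ∑ η, cv η * ψ (dt x η) := by
    intro x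
    simp only [hcv, sum_mul]
    rw [sum_comm, sq]
    simp only [hH]
    rw [sum_mul]
    refine sum_congr rfl fun ξ _ => ?_
    rw [mul_sum, ← Equiv.sum_comp (Equiv.subRight ξ)]
    refine sum_congr rfl fun η _ => ?_
    simp only [Equiv.subRight_apply]
    have : dt x η = dt x ξ + dt x (η - ξ) := by simp only [dt, Pi.sub_apply]; ring
    rw [this, AddChar.map_add_eq_mul]; ring
  have h5 : ∑ x ∈ E, (‖H x‖ ^ 2) ^ 2 ≤ (Fintype.card K : ℝ) ^ 2 * ∑ η, ‖cv η‖ ^ 2 := by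
    rw [← planch2 hψ]
    calc ∑ x ∈ E, (‖H x‖ ^ 2) ^ 2 ≤ ∑ x, (‖H x‖ ^ 2) ^ 2 :=
          sum_le_sum_of_subset_of_nonneg (subset_univ _) fun _ _ _ => by positivity
      _ = _ := sum_congr rfl fun x _ => by rw [← hHsq, norm_pow]
  have hcv0 : ‖cv 0‖ ^ 2 ≤ σ ^ 2 := by
    have a1 : ‖cv 0‖ ≤ ∑ ξ, ‖F ξ‖ * ‖F (-ξ)‖ := by
      refine (norm_sum_le _ _).trans (sum_le_sum fun ξ _ => ?_)
      rw [norm_mul, zero_sub]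
    have a2 := sum_mul_sq_le_sq_mul_sq univ (fun ξ => ‖F ξ‖) (fun ξ => ‖F (-ξ)‖)
    have a3 : ∑ ξ, ‖F (-ξ)‖ ^ 2 = σ := by
      rw [← hFσ]; exact Equiv.sum_comp (Equiv.neg _) (fun ξ => ‖F ξ‖ ^ 2)
    rw [a3, hFσ] at a2
    calc ‖cv 0‖ ^ 2 ≤ _ := pow_le_pow_left₀ (norm_nonneg _) a1 2
      _ ≤ σ * σ := a2
      _ = σ ^ 2 := by ring
  have hcvη : ∀ η, η ≠ 0 → ‖cv η‖ ^ 2 ≤ 2 * ∑ ξ, ‖F ξ‖ ^ 2 * ‖F (η - ξ)‖ ^ 2 := by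
    intro η hη
    have b1 : cv η = ∑ ξ with nm ξ = t ∧ nm (η - ξ) = t, F ξ * F (η - ξ) := by
      simp only [hcv]
      rw [sum_filter_of_ne]
      intro ξ _ hne
      by_contra hc
      apply hne
      simp only [hF]
      rw [not_and_or] at hc
      rcases hc with hc | hc <;> simp [hc]
    have b2 : ‖cv η‖ ≤ ∑ ξ with nm ξ = t ∧ nm (η - ξ) = t, ‖F ξ * F (η - ξ)‖ := by
      rw [b1]; exact norm_sum_le _ _
    calc ‖cv η‖ ^ 2 ≤ _ := pow_le_pow_left₀ (norm_nonneg _) b2 2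
      _ ≤ _ := sq_sum_le_card_mul_sum_sq
      _ ≤ 2 * ∑ ξ, ‖F ξ * F (η - ξ)‖ ^ 2 := by
          refine mul_le_mul ?_ ?_ (sum_nonneg fun _ _ => by positivity) (by norm_num)
          · exact_mod_cast circ hK t ht η hη
          · exact sum_le_sum_of_subset_of_nonneg (subset_univ _) fun _ _ _ => by positivity
      _ = _ := by simp only [norm_mul, mul_pow]
  have h6 : ∑ η, ‖cv η‖ ^ 2 ≤ 3 * σ ^ 2 := by
    have c1 : ∑ η, 2 * ∑ ξ, ‖F ξ‖ ^ 2 * ‖F (η - ξ)‖ ^ 2 = 2 * σ ^ 2 := by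
      rw [← mul_sum, sum_comm]
      congr 1
      simp_rw [← mul_sum]
      have : ∀ ξ, ∑ η, ‖F (η - ξ)‖ ^ 2 = σ := by
        intro ξ
        rw [← hFσ]; exact Equiv.sum_comp (Equiv.subRight ξ) (fun ξ => ‖F ξ‖ ^ 2)
      simp_rw [this]
      rw [← sum_mul, hFσ]; ring
    rw [← add_sum_erase _ _ (mem_univ 0)]
    have c2 : ∑ η ∈ univ.erase 0, ‖cv η‖ ^ 2 ≤ ∑ η, 2 * ∑ ξ, ‖F ξ‖ ^ 2 * ‖F (η - ξ)‖ ^ 2 :=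
      (sum_le_sum fun η hη => hcvη η (by simpa using hη)).trans
        (sum_le_sum_of_subset_of_nonneg (subset_univ _) fun _ _ _ => by positivity)
    linarith
  have h7 : ∑ x ∈ E, (‖H x‖ ^ 2) ^ 2 ≤ 3 * (Fintype.card K : ℝ) ^ 2 * σ ^ 2 := by
    refine h5.trans ?_
    calc _ ≤ (Fintype.card K : ℝ) ^ 2 * (3 * σ ^ 2) := by gcongr
      _ = _ := by ring
  calc σ ^ 4 = (σ ^ 2) ^ 2 := by ring
    _ ≤ (#E * ∑ x ∈ E, ‖H x‖ ^ 2) ^ 2 := by gcongr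
    _ = (#E : ℝ) ^ 2 * (∑ x ∈ E, ‖H x‖ ^ 2) ^ 2 := by ring
    _ ≤ (#E : ℝ) ^ 2 * (#E * (3 * (Fintype.card K : ℝ) ^ 2 * σ ^ 2)) := by
        gcongr
        exact h4.trans (by gcongr)
    _ = _ := by ring

lemma nu_zero_le : nu E 0 ≤ 2 * (Fintype.card K : ℝ) * #E := by
  have h1 : #{z : Fin 2 → K | nm z = 0} ≤ 2 * Fintype.card K := by
    refine card_le_mul_card_image_of_maps_to (f := fun z : Fin 2 → K => z 0) (t := univ)
      (fun _ _ => mem_univ _) 2 ?_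
    intro a _
    rcases (filter (fun z : Fin 2 → K => z 0 = a) {z : Fin 2 → K | nm z = 0}).eq_empty_or_nonempty with h | ⟨ξ, hξ⟩
    · rw [h]; simp
    refine (card_le_card (t := {ξ, ![a, -ξ 1]}) ?_).trans card_le_two
    intro ζ hζ
    obtain ⟨hξ1, hξ2⟩ := mem_filter.1 hξ
    obtain ⟨hζ1, hζ2⟩ := mem_filter.1 hζ
    replace hξ1 := (mem_filter.1 hξ1).2
    replace hζ1 := (mem_filter.1 hζ1).2
    simp only [nm] at hξ1 hζ1
    rw [hξ2] at hξ1
    rw [hζ2] at hζ1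
    have : ζ 1 ^ 2 = ξ 1 ^ 2 := by linear_combination hζ1 - hξ1
    simp only [mem_insert, mem_singleton]
    rcases sq_eq_sq_iff_eq_or_eq_neg.1 this with h | h
    · left; ext i; fin_cases i
      · simp [hξ2, hζ2]
      · simpa using h
    · right; ext i; fin_cases i
      · simp [hζ2]
      · simpa using h
  have h2 : #{p ∈ E ×ˢ E | nm (p.1 - p.2) = 0} ≤ #(E ×ˢ ({z : Fin 2 → K | nm z = 0} : Finset _)) := by
    refine card_le_card_of_injOn (fun p => (p.1, p.1 - p.2)) ?_ ?_
    · intro p hp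
      have := mem_filter.1 hp
      simp only [mem_product] at this
      simp [this.1.1, this.2]
    · rintro ⟨a, b⟩ _ ⟨c, d⟩ _ h
      simp only [Prod.mk.injEq] at h
      obtain ⟨rfl, h⟩ := h
      simpa using h
  rw [card_product] at h2
  have h3 := h2.trans (Nat.mul_le_mul_left _ h1)
  have h4 : nu E 0 ≤ ((#E * (2 * Fintype.card K) : ℕ) : ℝ) := by
    simp only [nu]; exact_mod_cast h3
  push_cast at h4
  linarith

set_option maxHeartbeats 2000000 in
lemma main (hK : ringChar K ≠ 2) (h4q : 4 * (Fintype.card K : ℝ) ≤ #E)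
    (h3 : 3 * (Fintype.card K : ℝ) ^ 4 ≤ (#E : ℝ) ^ 3) :
    (1 / 28) * (Fintype.card K : ℝ) ≤ #((E ×ˢ E).image fun p => nm (p.1 - p.2)) := by
  set ψ := AddChar.FiniteField.primitiveChar_to_Complex K with hψd
  have hψ : ψ.IsPrimitive := AddChar.FiniteField.primitiveChar_to_Complex_isPrimitive K
  have Hsum := sum_sg E hψ
  have Hsq := id_sq E hK hψ
  have H0 := id_zero E hK hψ
  have Hnu := sum_nu E
  have Hnu0 := nu_zero_le E
  have hL4 := l4 E hK hψ
  have hnn : ∀ t, 0 ≤ nu E t := fun t => by unfold nu; positivity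
  have hsn : ∀ t, 0 ≤ sg ψ E t := fun t => sum_nonneg fun _ _ => by positivity
  have hq : (1 : ℝ) ≤ Fintype.card K := by exact_mod_cast Fintype.card_pos
  set D := (E ×ˢ E).image fun p => nm (p.1 - p.2) with hD
  set q : ℝ := ((Fintype.card K : ℕ) : ℝ)
  set e : ℝ := (#E : ℝ)
  have he : 0 < e := by linarith
  -- bound on sg
  have hM : ∀ t, t ≠ 0 → sg ψ E t ≤ e ^ 3 / q := by
    intro t ht
    rcases (hsn t).eq_or_lt with h | h
    · rw [← h]; positivity
    have h5 : sg ψ E t ^ 2 ≤ 3 * q ^ 2 * e ^ 3 := by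
      have := hL4 t ht
      have h6 : 0 < sg ψ E t ^ 2 := by positivity
      nlinarith
    refine (pow_le_pow_iff_left₀ (hsn t) (by positivity) two_ne_zero).1 ?_
    rw [div_pow, le_div_iff₀ (by positivity)]
    calc _ ≤ (3 * q ^ 2 * e ^ 3) * q ^ 2 := by gcongr
      _ = (3 * q ^ 4) * e ^ 3 := by ring
      _ ≤ e ^ 3 * e ^ 3 := by gcongr
      _ = _ := by ring
  have hS : ∑ t ∈ univ.erase 0, sg ψ E t ^ 2 ≤ e ^ 3 / q * (q ^ 2 * e) := by
    rw [← Hsum, mul_sum]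
    calc _ ≤ ∑ t ∈ univ.erase 0, e ^ 3 / q * sg ψ E t := by
          refine sum_le_sum fun t ht => ?_
          rw [sq]
          exact mul_le_mul_of_nonneg_right (hM t (by simpa using ht)) (hsn t)
      _ ≤ _ := sum_le_sum_of_subset_of_nonneg (subset_univ _) fun t _ _ => by
          have := hsn t
          positivity
  have hS' : ∑ t ∈ univ.erase 0, sg ψ E t ^ 2 ≤ e ^ 4 * q := by
    refine hS.trans (le_of_eq ?_); field_simp
  rw [← add_sum_erase _ _ (mem_univ (0 : K)), ← add_sum_erase _ (fun t => nu E t ^ 2) (mem_univ (0 : K))] at Hsq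
  rw [← add_sum_erase _ _ (mem_univ (0 : K))] at Hnu
  have hn0 := hnn 0
  have hs0 := hsn 0
  set S := ∑ t ∈ univ.erase 0, sg ψ E t ^ 2
  set N := ∑ t ∈ univ.erase 0, nu E t ^ 2 with hN
  set s0 := sg ψ E 0
  set n0 := nu E 0
  have hNle : q * N ≤ 6 * e ^ 4 := by
    have hq2 : 0 < q ^ 2 := by positivity
    have hqe : q * e ≤ e ^ 2 := by nlinarith
    have hqS : q * S ≤ q ^ 2 * e ^ 4 := by nlinarith
    have hq0 : 0 < q := by linarith
    have hpos : 0 ≤ q ^ 4 * e ^ 2 := by positivity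
    have hgoal : q ^ 2 * (q * N) ≤ q ^ 2 * (6 * e ^ 4) := by
      rcases eps_cases (K := K) with h | h
      · rw [h] at H0
        have g1 : s0 = q * e + q * n0 - e ^ 2 := by
          apply mul_left_cancel₀ hq0.ne'; rw [H0]; push_cast; ring
        have g2 : s0 ^ 2 ≤ (q * n0) ^ 2 := pow_le_pow_left₀ hs0 (by linarith) 2
        have g3 : q * s0 ^ 2 ≤ q * (q * n0) ^ 2 := by gcongr
        have g4 : 0 ≤ q ^ 2 * e ^ 4 := by positivity
        nlinarith
      · rw [h] at H0
        have g1 : s0 = q * e + e ^ 2 - q * n0 := by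
          apply mul_left_cancel₀ hq0.ne'; rw [H0]; push_cast; ring
        have g0 : 0 ≤ q * n0 := by positivity
        have g2 : s0 ^ 2 ≤ (2 * e ^ 2) ^ 2 := pow_le_pow_left₀ hs0 (by linarith) 2
        have g3 : q * s0 ^ 2 ≤ q ^ 2 * (2 * e ^ 2) ^ 2 := by
          calc _ ≤ q * (2 * e ^ 2) ^ 2 := by gcongr
            _ ≤ _ := by
              gcongr
              nlinarith
        have g4 : 0 ≤ q ^ 3 * n0 ^ 2 := by positivity
        nlinarith
    exact le_of_mul_le_mul_left hgoal hq2
  have hCS : (∑ t ∈ univ.erase 0, nu E t) ^ 2 ≤ #D * N := by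
    have hz : ∀ t, t ∉ D → nu E t = 0 := by
      intro t ht
      simp only [nu]
      rw [Nat.cast_eq_zero, card_eq_zero, filter_eq_empty_iff]
      intro p hp hpt
      exact ht (mem_image.2 ⟨p, hp, hpt⟩)
    have d1 : ∑ t ∈ univ.erase 0, nu E t = ∑ t ∈ D.erase 0, nu E t := by
      symm
      refine sum_subset (erase_subset_erase _ (subset_univ _)) fun t ht htn => ?_
      apply hz; intro h; exact htn (mem_erase.2 ⟨(mem_erase.1 ht).1, h⟩)
    rw [d1]
    refine sq_sum_le_card_mul_sum_sq.trans ?_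
    refine mul_le_mul ?_ ?_ (sum_nonneg fun _ _ => by positivity) (by positivity)
    · exact_mod_cast card_le_card (erase_subset _ _)
    · exact sum_le_sum_of_subset_of_nonneg (erase_subset_erase _ (subset_univ _)) fun _ _ _ => by positivity
  have hhalf : e ^ 2 / 2 ≤ ∑ t ∈ univ.erase 0, nu E t := by nlinarith
  have h8 : (e ^ 2 / 2) ^ 2 ≤ #D * N := (pow_le_pow_left₀ (by positivity) hhalf 2).trans hCS
  have h9 : q * (e ^ 4 / 4) ≤ #D * (6 * e ^ 4) := by
    calc q * (e ^ 4 / 4) = q * (e ^ 2 / 2) ^ 2 := by ring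
      _ ≤ q * (#D * N) := by gcongr
      _ = #D * (q * N) := by ring
      _ ≤ _ := by gcongr
  have h10 : 0 < e ^ 4 := by positivity
  have h11 : q / 4 ≤ #D * 6 := by
    refine le_of_mul_le_mul_right ?_ h10
    linarith
  linarith

end

end CEHIK


/-- Chapman–Erdoğan–Hart–Iosevich–Koh: for `P(x) = x₁² + x₂²` there
are absolute constants `C, c > 0` such that for every finite field of odd
characteristic and every `E ⊆ F_q²` with `|E| ≥ C q^{4/3}`,
`|Δ_P(E,E)| ≥ c q`. -/
theorem stmt18 :
    ∃ C : ℝ, 0 < C ∧ ∃ c : ℝ, 0 < c ∧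
      ∀ (K : Type) [Field K] [Fintype K] [DecidableEq K],
        ringChar K ≠ 2 →
        ∀ E : Finset (Fin 2 → K),
          C * (Fintype.card K : ℝ) ^ ((4 : ℝ) / 3) ≤ (E.card : ℝ) →
          c * (Fintype.card K : ℝ) ≤
            (((E ×ˢ E).image
              (fun p => ∑ j, (p.1 j - p.2 j) ^ 2)).card : ℝ) := by
  refine ⟨4, by norm_num, 1 / 28, by norm_num, ?_⟩
  intro K _ _ _ hK E hE
  have hq : (1 : ℝ) ≤ Fintype.card K := by exact_mod_cast Fintype.card_pos
  have h := CEHIK.main E hK ?_ ?_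
  · have e : (fun p : (Fin 2 → K) × (Fin 2 → K) => CEHIK.nm (p.1 - p.2)) =
        fun p => ∑ j, (p.1 j - p.2 j) ^ 2 := by
      funext p
      simp [CEHIK.nm, Fin.sum_univ_two]
    rw [e] at h
    exact h
  · refine le_trans ?_ hE
    have : (Fintype.card K : ℝ) ^ (1 : ℝ) ≤ (Fintype.card K : ℝ) ^ ((4 : ℝ) / 3) :=
      Real.rpow_le_rpow_of_exponent_le hq (by norm_num)
    rw [Real.rpow_one] at this
    linarith
  · have h3 : (4 * (Fintype.card K : ℝ) ^ ((4 : ℝ) / 3)) ^ 3 ≤ (E.card : ℝ) ^ 3 :=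
      pow_le_pow_left₀ (by positivity) hE 3
    have h4 : ((Fintype.card K : ℝ) ^ ((4 : ℝ) / 3)) ^ 3 = (Fintype.card K : ℝ) ^ 4 := by
      rw [← Real.rpow_natCast, ← Real.rpow_mul (by positivity), ← Real.rpow_natCast]
      norm_num
    rw [mul_pow, h4] at h3
    have : (0 : ℝ) ≤ (Fintype.card K : ℝ) ^ 4 := by positivity
    linarith
end

section
/- Let P(x) = x_1^2 + x_2^2 ∈ F_q[x_1,x_2]. There exist absolute constants C > 0 and c > 0 such that for every finite field F_q of odd characteristic and all sets E, F ⊆ F_q^2 with |E|·|F| ≥ C q^{8/3}, the distance set satisfies |Δ_P(E,F)| ≥ c q. -/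
open Finset ComplexConjugate

def nm {K : Type} [Field K] (z : K × K) : K := z.1 ^ 2 + z.2 ^ 2
def dt {K : Type} [Field K] (x y : K × K) : K := x.1 * y.1 + x.2 * y.2

lemma planch {ι X : Type} [Fintype ι] [Fintype X] [DecidableEq ι] (e : ι → X → ℂ) (Q : ℝ)
    (h : ∀ a b, ∑ x, e a x * conj (e b x) = if a = b then (Q : ℂ) else 0) (f : ι → ℂ) :
    ∑ x, ‖∑ a, f a * e a x‖ ^ 2 = Q * ∑ a, ‖f a‖ ^ 2 := by
  have key : ∑ x, (∑ a, f a * e a x) * conj (∑ a, f a * e a x)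
      = (Q : ℂ) * ∑ a, f a * conj (f a) := by
    calc _ = ∑ x, ∑ a, ∑ b, (f a * conj (f b)) * (e a x * conj (e b x)) := by
          refine sum_congr rfl fun x _ => ?_
          rw [map_sum, sum_mul_sum]
          refine sum_congr rfl fun a _ => sum_congr rfl fun b _ => ?_
          rw [map_mul]; ring
      _ = ∑ a, ∑ b, (f a * conj (f b)) * ∑ x, e a x * conj (e b x) := by
          rw [sum_comm]
          refine sum_congr rfl fun a _ => ?_
          rw [sum_comm]
          refine sum_congr rfl fun b _ => ?_
          rw [mul_sum]
      _ = _ := by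
          rw [mul_sum]
          refine sum_congr rfl fun a _ => ?_
          simp [h, mul_comm]
  simp only [Complex.mul_conj, Complex.normSq_eq_norm_sq] at key
  exact_mod_cast key

section
set_option linter.unusedSectionVars false
variable {K : Type} [Field K] [Fintype K] [DecidableEq K]

lemma conj_psi (ψ : AddChar K ℂ) (a : K) : conj (ψ a) = ψ (-a) := by
  rw [AddChar.map_neg_eq_conj]

lemma orth1 (ψ : AddChar K ℂ) (hψ : ψ.IsPrimitive) (a b : K) :
    ∑ x, ψ (x * a) * conj (ψ (x * b)) = if a = b then ((Fintype.card K : ℝ) : ℂ) else 0 := by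
  have := AddChar.sum_mulShift (a - b) hψ
  simp only [sub_eq_zero] at this
  push_cast at this ⊢
  rw [← this]
  refine sum_congr rfl fun x _ => ?_
  rw [conj_psi, ← AddChar.map_add_eq_mul]; congr 1; ring

lemma orth2 (ψ : AddChar K ℂ) (hψ : ψ.IsPrimitive) (a b : K × K) :
    ∑ x : K × K, ψ (dt a x) * conj (ψ (dt b x))
      = if a = b then (((Fintype.card K : ℝ) ^ 2 : ℝ) : ℂ) else 0 := by
  have h1 := orth1 ψ hψ a.1 b.1
  have h2 := orth1 ψ hψ a.2 b.2
  have : ∑ x : K × K, ψ (dt a x) * conj (ψ (dt b x))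
    = (∑ x, ψ (x * a.1) * conj (ψ (x * b.1))) * ∑ x, ψ (x * a.2) * conj (ψ (x * b.2)) := by
    rw [sum_mul_sum, Fintype.sum_prod_type]
    refine sum_congr rfl fun x _ => sum_congr rfl fun y _ => ?_
    simp only [conj_psi, ← AddChar.map_add_eq_mul, dt]; congr 1; ring
  rw [this, h1, h2]
  by_cases e1 : a.1 = b.1 <;> by_cases e2 : a.2 = b.2 <;> simp [Prod.ext_iff, e1, e2]
  ring

lemma gauss (hK : ringChar K ≠ 2) (ψ : AddChar K ℂ) (hψ : ψ.IsPrimitive) :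
    ∃ κ : ℂ, ‖κ‖ = Fintype.card K ∧ ∀ a : K, a ≠ 0 → ∑ m : K × K, ψ (a * nm m) = κ := by
  set χ : MulChar K ℂ := (quadraticChar K).ringHomComp (Int.castRingHom ℂ) with hχ
  have hq : χ.IsQuadratic := (quadraticChar_isQuadratic K).comp _
  have hne : χ ≠ 1 := by
    rw [hχ, MulChar.ringHomComp_ne_one_iff (Int.castRingHom ℂ).injective_int]
    exact quadraticChar_ne_one hK
  refine ⟨χ (-1) * Fintype.card K, ?_, ?_⟩
  · rcases hq (-1) with h | h | h
    · exfalso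
      have : IsUnit (-1 : K) := by simp
      exact (this.map χ).ne_zero h
    · simp [h]
    · simp [h]
  · intro a ha
    have hp : (ψ.mulShift a).IsPrimitive := AddChar.IsPrimitive.of_ne_one (hψ ha)
    rw [← gaussSum_sq hne hq hp]
    have hs : ∑ x : K, ψ (a * x ^ 2) = gaussSum χ (ψ.mulShift a) := by
      have h1 : ∑ x : K, ψ (a * x ^ 2) = ∑ t : K, ((χ t) + 1) * ψ (a * t) := by
        rw [← sum_fiberwise (g := fun x : K => x ^ 2)]
        refine sum_congr rfl fun t _ => ?_
        have := quadraticChar_card_sqrts hK t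
        have h2 : ((#{x : K | x ^ 2 = t} : ℕ) : ℂ) = χ t + 1 := by
          have h3 : Set.toFinset {x : K | x ^ 2 = t} = ({x : K | x ^ 2 = t} : Finset K) := by
            ext; simp
          rw [h3] at this
          rw [hχ]
          simp only [MulChar.ringHomComp_apply, Int.coe_castRingHom]
          exact_mod_cast this
        rw [← h2, ← nsmul_eq_mul, ← sum_const]
        refine sum_congr rfl fun x hx => ?_
        rw [(mem_filter.1 hx).2]
      rw [h1, gaussSum]
      simp only [add_mul, sum_add_distrib, one_mul, AddChar.mulShift_apply]
      have := AddChar.sum_mulShift a hψ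
      simp only [ha, if_false] at this
      simp only [mul_comm a, this]
      simp
    rw [← hs, sq, sum_mul_sum, Fintype.sum_prod_type]
    refine sum_congr rfl fun x _ => sum_congr rfl fun y _ => ?_
    rw [← AddChar.map_add_eq_mul, nm]; congr 1; ring

lemma two_pts (hK : ringChar K ≠ 2) {r : K} (hr : r ≠ 0) {v a b : K × K} (hv : v ≠ 0)
    (ha : nm a = r) (ha' : nm (v - a) = r) (hb : nm b = r) (hb' : nm (v - b) = r) :
    b = a ∨ b = v - a := by
  have h2 : (2 : K) ≠ 0 := Ring.two_ne_zero hK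
  obtain ⟨v1, v2⟩ := v
  obtain ⟨a1, a2⟩ := a
  obtain ⟨b1, b2⟩ := b
  simp only [nm, Prod.mk_sub_mk, Prod.mk.injEq, ne_eq, Prod.mk_eq_zero] at *
  by_contra hcon
  push Not at hcon
  obtain ⟨hc1, hc2⟩ := hcon
  have e1 : v1 ^ 2 + v2 ^ 2 = 2 * (a1 * v1 + a2 * v2) := by linear_combination ha' - ha
  have e2 : v1 ^ 2 + v2 ^ 2 = 2 * (b1 * v1 + b2 * v2) := by linear_combination hb' - hb
  have dv : (b1 - a1) * v1 + (b2 - a2) * v2 = 0 := by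
    apply mul_left_cancel₀ h2; linear_combination e1 - e2
  have wv : (b1 + a1 - v1) * v1 + (b2 + a2 - v2) * v2 = 0 := by
    apply mul_left_cancel₀ h2; linear_combination - e1 - e2
  have wd : (b1 - a1) * (b1 + a1 - v1) + (b2 - a2) * (b2 + a2 - v2) = 0 := by
    linear_combination hb - ha - dv
  have cr : v1 * (b2 + a2 - v2) - v2 * (b1 + a1 - v1) = 0 := by
    by_cases hd : b1 - a1 = 0
    · have hd2 : b2 - a2 ≠ 0 := fun h => hc1 (sub_eq_zero.1 hd) (sub_eq_zero.1 h)
      apply mul_left_cancel₀ hd2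
      linear_combination v1 * wd - (b1 + a1 - v1) * dv
    · apply mul_left_cancel₀ hd
      linear_combination (b2 + a2 - v2) * dv - v2 * wd
  have n1 : (v1 ^ 2 + v2 ^ 2) * (b1 + a1 - v1) = 0 := by
    linear_combination v1 * wv - v2 * cr
  have n2 : (v1 ^ 2 + v2 ^ 2) * (b2 + a2 - v2) = 0 := by
    linear_combination v2 * wv + v1 * cr
  have hn : v1 ^ 2 + v2 ^ 2 = 0 := by
    by_contra hn
    have m1 := (mul_eq_zero.1 n1).resolve_left hn
    have m2 := (mul_eq_zero.1 n2).resolve_left hn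
    exact hc2 (by linear_combination m1) (by linear_combination m2)
  have av : a1 * v1 + a2 * v2 = 0 := by
    apply mul_left_cancel₀ h2; linear_combination hn - e1
  have r1 : v1 ^ 2 * r = 0 := by
    rw [← ha]; linear_combination (a1 * v1 - a2 * v2) * av + a2 ^ 2 * hn
  have r2 : v2 ^ 2 * r = 0 := by
    rw [← ha]; linear_combination (a2 * v2 - a1 * v1) * av + a1 ^ 2 * hn
  have z1 : v1 = 0 := by simpa [hr] using r1
  have z2 : v2 = 0 := by simpa [hr] using r2
  exact hv ⟨z1, z2⟩

/-- Fourier transform of indicator. -/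
noncomputable def ft (ψ : AddChar K ℂ) (E : Finset (K × K)) (m : K × K) : ℂ :=
  ∑ x ∈ E, ψ (dt m x)

lemma ft_l2 (ψ : AddChar K ℂ) (hψ : ψ.IsPrimitive) (E : Finset (K × K)) :
    ∑ m, ‖ft ψ E m‖ ^ 2 = (Fintype.card K : ℝ) ^ 2 * #E := by
  have := planch (fun a x : K × K => ψ (dt a x)) _ (orth2 ψ hψ) (fun a => if a ∈ E then 1 else 0)
  have h2 : ∀ m x : K × K, dt m x = dt x m := fun m x => by simp only [dt]; ring
  simp only [ft]
  simpa [ite_pow, apply_ite, h2] using this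

lemma conv_bd (hK : ringChar K ≠ 2) {r : K} (hr : r ≠ 0) (g : K × K → ℂ)
    (hg : ∀ m, nm m ≠ r → g m = 0) :
    ∑ v, ‖∑ a, g a * g (v - a)‖ ^ 2 ≤ 3 * (∑ a, ‖g a‖ ^ 2) ^ 2 := by
  set X := ∑ a, ‖g a‖ ^ 2 with hX
  have hpt : ∀ v, ‖∑ a, g a * g (v - a)‖ ^ 2 ≤ (if v = 0 then X ^ 2 else 0)
      + 2 * ∑ a, ‖g a‖ ^ 2 * ‖g (v - a)‖ ^ 2 := by
    intro v
    have hnn : 0 ≤ ∑ a, ‖g a‖ ^ 2 * ‖g (v - a)‖ ^ 2 := sum_nonneg fun _ _ => by positivity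
    have htri : ‖∑ a, g a * g (v - a)‖ ≤ ∑ a, ‖g a‖ * ‖g (v - a)‖ := by
      refine (norm_sum_le _ _).trans_eq ?_
      simp
    by_cases hv : v = 0
    · subst hv
      simp only [if_true]
      have h1 : (∑ a, ‖g a‖ * ‖g (0 - a)‖) ^ 2 ≤ X * ∑ a, ‖g (0 - a)‖ ^ 2 :=
        sum_mul_sq_le_sq_mul_sq _ _ _
      have h3 : ∑ a, ‖g (0 - a)‖ ^ 2 = X :=
        Equiv.sum_comp (Equiv.subLeft (0 : K × K)) (fun a => ‖g a‖ ^ 2)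
      rw [h3] at h1
      have h4 := pow_le_pow_left₀ (norm_nonneg _) htri 2
      nlinarith
    · simp only [hv, if_false, zero_add]
      set Z : Finset (K × K) := univ.filter fun a => nm a = r ∧ nm (v - a) = r with hZ
      have hc : #Z ≤ 2 := by
        rcases Z.eq_empty_or_nonempty with h | ⟨a, ha⟩
        · simp [h]
        · refine (card_le_card (t := {a, v - a}) ?_).trans card_le_two
          intro b hb
          simp only [hZ, mem_filter, mem_univ, true_and] at ha hb
          simpa using two_pts hK hr hv ha.1 ha.2 hb.1 hb.2
      have hs : ∑ a, ‖g a‖ * ‖g (v - a)‖ = ∑ a ∈ Z, ‖g a‖ * ‖g (v - a)‖ := by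
        symm
        refine sum_subset (subset_univ _) fun a _ ha => ?_
        simp only [hZ, mem_filter, mem_univ, true_and, not_and_or] at ha
        rcases ha with h | h <;> simp [hg _ h]
      have h1 : (∑ a ∈ Z, ‖g a‖ * ‖g (v - a)‖) ^ 2 ≤ #Z * ∑ a ∈ Z, (‖g a‖ * ‖g (v - a)‖) ^ 2 :=
        sq_sum_le_card_mul_sum_sq
      have h2 : ∑ a ∈ Z, (‖g a‖ * ‖g (v - a)‖) ^ 2 ≤ ∑ a, ‖g a‖ ^ 2 * ‖g (v - a)‖ ^ 2 := by
        simp only [mul_pow]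
        exact sum_le_sum_of_subset_of_nonneg (subset_univ _) fun _ _ _ => by positivity
      have h3 : (#Z : ℝ) ≤ 2 := by exact_mod_cast hc
      rw [hs] at htri
      calc _ ≤ _ := pow_le_pow_left₀ (norm_nonneg _) htri 2
        _ ≤ _ := h1
        _ ≤ _ := mul_le_mul h3 h2 (sum_nonneg fun _ _ => by positivity) (by norm_num)
  refine (sum_le_sum fun v _ => hpt v).trans_eq ?_
  rw [sum_add_distrib, ← mul_sum, sum_comm]
  simp only [← mul_sum]
  have h3 : ∀ a, ∑ v, ‖g (v - a)‖ ^ 2 = X := fun a =>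
    Equiv.sum_comp (Equiv.subRight a) (fun a => ‖g a‖ ^ 2)
  simp only [h3, ← sum_mul, ← hX]
  simp
  ring

lemma circ (hK : ringChar K ≠ 2) (ψ : AddChar K ℂ) (hψ : ψ.IsPrimitive) {r : K} (hr : r ≠ 0)
    (E : Finset (K × K)) :
    (∑ m with nm m = r, ‖ft ψ E m‖ ^ 2) ^ 2 ≤ 3 * (Fintype.card K : ℝ) ^ 2 * (#E : ℝ) ^ 3 := by
  set X := ∑ m with nm m = r, ‖ft ψ E m‖ ^ 2 with hX
  have hX0 : 0 ≤ X := sum_nonneg fun _ _ => by positivity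
  set g : K × K → ℂ := fun m => if nm m = r then conj (ft ψ E m) else 0 with hg
  set T : K × K → ℂ := fun x => ∑ m, g m * ψ (dt m x) with hT
  have hgX : ∑ a, ‖g a‖ ^ 2 = X := by
    rw [hX, sum_filter]
    refine sum_congr rfl fun a _ => ?_
    simp only [hg]; split_ifs <;> simp
  have h1 : (X : ℂ) = ∑ x ∈ E, T x := by
    simp only [hT]
    rw [sum_comm, hX, sum_filter]
    push_cast
    refine sum_congr rfl fun m _ => ?_
    rw [← mul_sum, ← ft]
    simp only [hg]; split_ifs
    · rw [Complex.conj_mul']; simp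
    · simp
  have h2 : X ≤ ∑ x ∈ E, ‖T x‖ := by
    calc X = ‖(X : ℂ)‖ := by simp [abs_of_nonneg hX0]
      _ ≤ _ := by rw [h1]; exact norm_sum_le _ _
  have hsq : ∀ x, T x ^ 2 = ∑ v, (∑ a, g a * g (v - a)) * ψ (dt v x) := by
    intro x
    simp only [hT, sq, sum_mul_sum]
    simp only [sum_mul]
    rw [sum_comm (s := univ (α := K × K)) (t := univ (α := K × K))
      (f := fun v a => g a * g (v - a) * ψ (dt v x))]
    refine sum_congr rfl fun a _ => ?_
    rw [← Equiv.sum_comp (Equiv.addLeft a) (fun v => g a * g (v - a) * ψ (dt v x))]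
    refine sum_congr rfl fun b _ => ?_
    have : dt (a + b) x = dt a x + dt b x := by simp only [dt, Prod.fst_add, Prod.snd_add]; ring
    simp only [Equiv.coe_addLeft, add_sub_cancel_left, this, AddChar.map_add_eq_mul]
    ring
  have h4 : ∑ x, ‖T x‖ ^ 4 ≤ (Fintype.card K : ℝ) ^ 2 * (3 * X ^ 2) := by
    have : ∀ x, ‖T x‖ ^ 4 = ‖∑ v, (∑ a, g a * g (v - a)) * ψ (dt v x)‖ ^ 2 := by
      intro x; rw [← hsq, norm_pow]; ring
    simp only [this]
    rw [planch (fun a x : K × K => ψ (dt a x)) _ (orth2 ψ hψ)]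
    refine mul_le_mul_of_nonneg_left ?_ (by positivity)
    rw [← hgX]
    exact conv_bd hK hr g fun m hm => by simp [hg, hm]
  have h5 : (∑ x ∈ E, ‖T x‖) ^ 2 ≤ #E * ∑ x ∈ E, ‖T x‖ ^ 2 := sq_sum_le_card_mul_sum_sq
  have h6 : (∑ x ∈ E, ‖T x‖ ^ 2) ^ 2 ≤ #E * ∑ x ∈ E, (‖T x‖ ^ 2) ^ 2 := sq_sum_le_card_mul_sum_sq
  have h7 : ∑ x ∈ E, (‖T x‖ ^ 2) ^ 2 ≤ ∑ x, ‖T x‖ ^ 4 := by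
    simp only [← pow_mul]
    exact sum_le_sum_of_subset_of_nonneg (subset_univ _) fun _ _ _ => by positivity
  have h8 : X ^ 4 ≤ (#E : ℝ) ^ 3 * ((Fintype.card K : ℝ) ^ 2 * (3 * X ^ 2)) := by
    calc X ^ 4 = (X ^ 2) ^ 2 := by ring
      _ ≤ (#E * ∑ x ∈ E, ‖T x‖ ^ 2) ^ 2 := by
        gcongr; exact (pow_le_pow_left₀ hX0 h2 2).trans h5
      _ = (#E : ℝ) ^ 2 * (∑ x ∈ E, ‖T x‖ ^ 2) ^ 2 := by ring
      _ ≤ (#E : ℝ) ^ 2 * (#E * ((Fintype.card K : ℝ) ^ 2 * (3 * X ^ 2))) := by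
        gcongr; refine h6.trans ?_; gcongr; exact h7.trans h4
      _ = _ := by ring
  rcases hX0.eq_or_lt with h | h
  · rw [← h, zero_pow two_ne_zero]; positivity
  · have : 0 < X ^ 2 := by positivity
    refine le_of_mul_le_mul_right ?_ this
    linarith

lemma gauss_ft (hK : ringChar K ≠ 2) (ψ : AddChar K ℂ) (κ : ℂ)
    (hκ : ∀ a : K, a ≠ 0 → ∑ m : K × K, ψ (a * nm m) = κ) {s : K} (hs : s ≠ 0) (z : K × K) :
    κ * ψ (s * nm z) = ∑ m, ψ (-(4 * s)⁻¹ * nm m) * ψ (dt m z) := by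
  have h2 : (2 : K) ≠ 0 := Ring.two_ne_zero hK
  have h4 : (4 : K) ≠ 0 := by
    have : (4 : K) = 2 * 2 := by norm_num
    rw [this]; exact mul_ne_zero h2 h2
  rw [← hκ (-(4 * s)⁻¹) (neg_ne_zero.2 (inv_ne_zero (mul_ne_zero h4 hs))), sum_mul,
    ← Equiv.sum_comp (Equiv.addRight (2 * s * z.1, 2 * s * z.2))
      (fun m => ψ (-(4 * s)⁻¹ * nm m) * ψ (dt m z))]
  refine sum_congr rfl fun m _ => ?_
  simp only [← AddChar.map_add_eq_mul]
  congr 1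
  simp only [nm, dt, Equiv.coe_addRight, Prod.fst_add, Prod.snd_add]
  field_simp
  ring

lemma iso_count (E F : Finset (K × K)) :
    (#{p ∈ E ×ˢ F | nm (p.1 - p.2) = 0} : ℝ) ≤ 2 * Fintype.card K * #E ∧
    (#{p ∈ E ×ˢ F | nm (p.1 - p.2) = 0} : ℝ) ≤ 2 * Fintype.card K * #F := by
  have h0 : #{z : K × K | nm z = 0} ≤ 2 * Fintype.card K := by
    rw [card_eq_sum_card_fiberwise (f := Prod.fst) (t := univ) (fun _ _ => by simp)]
    rw [mul_comm, ← smul_eq_mul, ← card_univ, ← sum_const]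
    refine sum_le_sum fun x _ => ?_
    by_cases hx : ∃ i : K, x ^ 2 + i ^ 2 = 0
    · obtain ⟨i, hi⟩ := hx
      refine (card_le_card (t := {(x, i), (x, -i)}) ?_).trans card_le_two
      rintro ⟨a, b⟩ hz
      simp only [mem_filter, mem_univ, true_and] at hz
      obtain ⟨hz, rfl⟩ := hz
      replace hz : a ^ 2 + b ^ 2 = 0 := hz
      have : b ^ 2 = i ^ 2 := by linear_combination hz - hi
      rcases sq_eq_sq_iff_eq_or_eq_neg.1 this with h | h <;> simp [h]
    · rw [card_eq_zero.2]; · simp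
      rw [eq_empty_iff_forall_notMem]
      rintro ⟨a, b⟩ hz
      simp only [mem_filter, mem_univ, true_and] at hz
      obtain ⟨hz, rfl⟩ := hz
      replace hz : a ^ 2 + b ^ 2 = 0 := hz
      exact hx ⟨b, hz⟩
  constructor
  · have : #{p ∈ E ×ˢ F | nm (p.1 - p.2) = 0} ≤ #(({z : K × K | nm z = 0} : Finset _) ×ˢ E) := by
      refine card_le_card_of_injOn (fun p => (p.1 - p.2, p.1)) ?_ ?_
      · intro p hp
        simp only [coe_filter, mem_product, Set.mem_ofPred_eq] at hp
        simp [hp.1.1, hp.2]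
      · rintro ⟨a, b⟩ _ ⟨c, d⟩ _ h
        simp only [Prod.mk.injEq] at h
        obtain ⟨h1, rfl⟩ := h
        simpa using h1
    rw [card_product] at this
    exact_mod_cast this.trans (Nat.mul_le_mul_right _ h0)
  · have : #{p ∈ E ×ˢ F | nm (p.1 - p.2) = 0} ≤ #(({z : K × K | nm z = 0} : Finset _) ×ˢ F) := by
      refine card_le_card_of_injOn (fun p => (p.1 - p.2, p.2)) ?_ ?_
      · intro p hp
        simp only [coe_filter, mem_product, Set.mem_ofPred_eq] at hp
        simp [hp.1.2, hp.2]
      · rintro ⟨a, b⟩ _ ⟨c, d⟩ _ h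
        simp only [Prod.mk.injEq] at h
        obtain ⟨h1, rfl⟩ := h
        simpa using h1
    rw [card_product] at this
    exact_mod_cast this.trans (Nat.mul_le_mul_right _ h0)

/-- Shell sums. -/
noncomputable def sh (ψ : AddChar K ℂ) (E F : Finset (K × K)) (r : K) : ℂ :=
  ∑ m with nm m = r, ft ψ E m * conj (ft ψ F m)

/-- Number of pairs at a given distance. -/
def nu (E F : Finset (K × K)) (t : K) : ℕ := #{p ∈ E ×ˢ F | nm (p.1 - p.2) = t}

lemma sh_cs (ψ : AddChar K ℂ) (E F : Finset (K × K)) (S : Finset (K × K)) :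
    (∑ m ∈ S, ‖ft ψ E m * conj (ft ψ F m)‖) ^ 2
      ≤ (∑ m ∈ S, ‖ft ψ E m‖ ^ 2) * ∑ m ∈ S, ‖ft ψ F m‖ ^ 2 := by
  simp only [norm_mul, RCLike.norm_conj]
  exact sum_mul_sq_le_sq_mul_sq _ _ _

lemma sh_bounds (hK : ringChar K ≠ 2) (ψ : AddChar K ℂ) (hψ : ψ.IsPrimitive)
    (E F : Finset (K × K)) (n : ℝ) (hn : 0 ≤ n) (hN : n ^ 4 = (#E : ℝ) * #F) :
    (∑ r, ‖sh ψ E F r‖ ≤ (Fintype.card K : ℝ) ^ 2 * n ^ 2) ∧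
    ∀ r, r ≠ 0 → ‖sh ψ E F r‖ ≤ 2 * Fintype.card K * n ^ 3 := by
  set q : ℝ := (Fintype.card K : ℝ) with hq
  have hq0 : 0 ≤ q := by positivity
  constructor
  · have h1 : ∑ r, ‖sh ψ E F r‖ ≤ ∑ m, ‖ft ψ E m * conj (ft ψ F m)‖ := by
      rw [← sum_fiberwise (g := fun m : K × K => nm m)]
      exact sum_le_sum fun r _ => norm_sum_le _ _
    refine h1.trans (le_of_sq_le_sq ?_ (by positivity))
    refine (sh_cs ψ E F univ).trans_eq ?_
    rw [ft_l2 ψ hψ, ft_l2 ψ hψ, ← hq]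
    linear_combination - q ^ 4 * hN
  · intro r hr
    have h1 := circ hK ψ hψ hr E
    have h2 := circ hK ψ hψ hr F
    have h3 := sh_cs ψ E F (univ.filter fun m => nm m = r)
    rw [← hq] at h1 h2
    refine (norm_sum_le _ _).trans ?_
    refine le_of_pow_le_pow_left₀ (n := 4) (by norm_num) (by positivity) ?_
    calc _ = ((∑ m with nm m = r, ‖ft ψ E m * conj (ft ψ F m)‖) ^ 2) ^ 2 := by ring
      _ ≤ _ := pow_le_pow_left₀ (by positivity) h3 2
      _ = (∑ m with nm m = r, ‖ft ψ E m‖ ^ 2) ^ 2 * (∑ m with nm m = r, ‖ft ψ F m‖ ^ 2) ^ 2 := by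
        ring
      _ ≤ (3 * q ^ 2 * (#E : ℝ) ^ 3) * (3 * q ^ 2 * (#F : ℝ) ^ 3) := by gcongr
      _ = 9 * q ^ 4 * (n ^ 4) ^ 3 := by rw [hN]; ring
      _ ≤ 16 * q ^ 4 * (n ^ 4) ^ 3 := by gcongr; norm_num
      _ = _ := by ring

lemma nu_formula (hK : ringChar K ≠ 2) (ψ : AddChar K ℂ) (hψ : ψ.IsPrimitive) (κ : ℂ)
    (hκ : ∀ a : K, a ≠ 0 → ∑ m : K × K, ψ (a * nm m) = κ)
    (E F : Finset (K × K)) {t : K} (ht : t ≠ 0) :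
    κ * Fintype.card K * nu E F t = κ * (#E * #F) - sh ψ E F 0
      + ∑ s, (if s = 0 then 0 else
          ∑ r, (if r = 0 then 0 else sh ψ E F r) * ψ (-(4 * s)⁻¹ * r)) * ψ (-t * s) := by
  set H : K → ℂ := fun s => ∑ p ∈ E ×ˢ F, ψ (s * nm (p.1 - p.2)) with hH
  have h1 : (Fintype.card K : ℂ) * nu E F t = ∑ s, H s * ψ (-t * s) := by
    simp only [hH, sum_mul]
    rw [sum_comm, nu, card_filter]
    push_cast
    rw [mul_sum]
    refine sum_congr rfl fun p _ => ?_
    have := AddChar.sum_mulShift (nm (p.1 - p.2) - t) hψ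
    simp only [sub_eq_zero] at this
    have h3 : ∑ s, ψ (s * nm (p.1 - p.2)) * ψ (-t * s)
        = ∑ s, ψ (s * (nm (p.1 - p.2) - t)) := by
      refine sum_congr rfl fun s _ => ?_
      rw [← AddChar.map_add_eq_mul]; congr 1; ring
    rw [h3, this]
    split_ifs <;> simp
  have hH0 : H 0 = #E * #F := by simp [hH]
  have hHs : ∀ s, s ≠ 0 → κ * H s = sh ψ E F 0
      + ∑ r, (if r = 0 then 0 else sh ψ E F r) * ψ (-(4 * s)⁻¹ * r) := by
    intro s hs
    have e1 : κ * H s = ∑ m, (ft ψ E m * conj (ft ψ F m)) * ψ (-(4 * s)⁻¹ * nm m) := by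
      simp only [hH, mul_sum, gauss_ft hK ψ κ hκ hs]
      rw [sum_comm]
      refine sum_congr rfl fun m _ => ?_
      rw [← mul_sum, mul_comm]
      congr 1
      rw [ft, ft, map_sum, sum_mul_sum, sum_product]
      refine sum_congr rfl fun x _ => sum_congr rfl fun y _ => ?_
      rw [conj_psi, ← AddChar.map_add_eq_mul]; congr 1
      simp only [dt, Prod.fst_sub, Prod.snd_sub]; ring
    have e2 : κ * H s = ∑ r, sh ψ E F r * ψ (-(4 * s)⁻¹ * r) := by
      rw [e1, ← sum_fiberwise (g := fun m : K × K => nm m)]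
      refine sum_congr rfl fun r _ => ?_
      rw [sh, sum_mul]
      refine sum_congr rfl fun m hm => ?_
      rw [(mem_filter.1 hm).2]
    rw [e2, ← add_sum_erase univ _ (mem_univ (0 : K)),
      ← add_sum_erase univ (fun r => (if r = 0 then 0 else sh ψ E F r) * ψ (-(4 * s)⁻¹ * r))
        (mem_univ (0 : K))]
    simp only [if_true, mul_zero, zero_mul, zero_add, AddChar.map_zero_eq_one, mul_one]
    congr 1
    refine sum_congr rfl fun r hr => ?_
    rw [if_neg (mem_erase.1 hr).1]
  have h0 : ∑ s ∈ univ.erase (0 : K), ψ (-t * s) = -1 := by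
    have := AddChar.sum_mulShift (-t) hψ
    simp only [neg_eq_zero, ht, if_false] at this
    rw [← add_sum_erase univ _ (mem_univ (0 : K))] at this
    simp only [zero_mul, AddChar.map_zero_eq_one, Nat.cast_zero] at this
    simp only [mul_comm (-t)]
    linear_combination this
  rw [mul_assoc, h1, ← add_sum_erase univ _ (mem_univ (0 : K)), hH0,
    ← add_sum_erase univ (fun s => (if s = 0 then 0 else
          ∑ r, (if r = 0 then 0 else sh ψ E F r) * ψ (-(4 * s)⁻¹ * r)) * ψ (-t * s))
          (mem_univ (0 : K))]
  have e3 : κ * ∑ s ∈ univ.erase (0 : K), H s * ψ (-t * s) =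
      sh ψ E F 0 * ∑ s ∈ univ.erase (0 : K), ψ (-t * s) +
      ∑ s ∈ univ.erase (0 : K), (if s = 0 then 0 else
          ∑ r, (if r = 0 then 0 else sh ψ E F r) * ψ (-(4 * s)⁻¹ * r)) * ψ (-t * s) := by
    rw [mul_sum, mul_sum, ← sum_add_distrib]
    refine sum_congr rfl fun s hs => ?_
    have hs0 := (mem_erase.1 hs).1
    rw [if_neg hs0, ← mul_assoc, hHs s hs0]
    ring
  rw [mul_add, e3, h0]
  simp
  ring

lemma W_bound (hK : ringChar K ≠ 2) (ψ : AddChar K ℂ) (hψ : ψ.IsPrimitive) (A : K → ℂ) :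
    ∑ t, ‖∑ s, (if s = 0 then 0 else ∑ r, A r * ψ (-(4 * s)⁻¹ * r)) * ψ (-t * s)‖ ^ 2
      ≤ (Fintype.card K : ℝ) ^ 2 * ∑ r, ‖A r‖ ^ 2 := by
  have h4 : (4 : K) ≠ 0 := by
    have h2 : (2 : K) ≠ 0 := Ring.two_ne_zero hK
    have : (4 : K) = 2 * 2 := by norm_num
    rw [this]; exact mul_ne_zero h2 h2
  have o2 : ∀ a b : K, ∑ x, ψ (-x * a) * conj (ψ (-x * b))
      = if a = b then ((Fintype.card K : ℝ) : ℂ) else 0 := by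
    intro a b
    rw [← orth1 ψ hψ a b]
    exact Equiv.sum_comp (Equiv.neg K) (fun x => ψ (x * a) * conj (ψ (x * b)))
  rw [planch (fun s t => ψ (-t * s)) _ o2, sq, mul_assoc]
  refine mul_le_mul_of_nonneg_left ?_ (by positivity)
  rw [← planch (fun r u => ψ (u * r)) _ (orth1 ψ hψ)]
  have hinj : Function.Injective (fun s : K => -(4 * s)⁻¹) := by
    intro a b h
    simpa [h4] using h
  rw [← (Equiv.ofBijective _ (Finite.injective_iff_bijective.1 hinj)).sum_comp
    (fun u => ‖∑ r, A r * ψ (u * r)‖ ^ 2)]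
  refine sum_le_sum fun s _ => ?_
  simp only [Equiv.ofBijective_apply]
  split_ifs
  · simp
  · exact le_rfl

lemma main_bd (hK : ringChar K ≠ 2) (E F : Finset (K × K)) (n : ℝ) (hn : 0 ≤ n)
    (hN : n ^ 4 = (#E : ℝ) * #F) (hbig : (Fintype.card K : ℝ) ^ 2 ≤ n ^ 3) :
    (Fintype.card K : ℝ) * ∑ t ∈ univ.erase (0 : K), (nu E F t : ℝ) ^ 2 ≤ 12 * (n ^ 4) ^ 2 := by
  obtain ⟨ψ, hψ⟩ : ∃ ψ : AddChar K ℂ, ψ.IsPrimitive := by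
    obtain ⟨ψ, hψ⟩ := AddChar.exists_apply_ne_zero.2 (one_ne_zero (α := K))
    exact ⟨ψ, AddChar.IsPrimitive.of_ne_one fun h => hψ (by rw [h]; simp)⟩
  obtain ⟨κ, hκn, hκ⟩ := gauss hK ψ hψ
  obtain ⟨hsum, hmax⟩ := sh_bounds hK ψ hψ E F n hn hN
  set q : ℝ := (Fintype.card K : ℝ) with hq
  have hq1 : 1 ≤ q := by
    rw [hq]; exact_mod_cast Fintype.card_pos
  set A : K → ℂ := fun r => if r = 0 then 0 else sh ψ E F r with hA
  have hW := W_bound hK ψ hψ A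
  rw [← hq] at hW
  set W : K → ℂ := fun t =>
    ∑ s, (if s = 0 then 0 else ∑ r, A r * ψ (-(4 * s)⁻¹ * r)) * ψ (-t * s) with hWd
  have hA2 : ∑ r, ‖A r‖ ^ 2 ≤ 2 * q ^ 3 * n ^ 5 := by
    calc _ ≤ ∑ r, (2 * q * n ^ 3) * ‖sh ψ E F r‖ := by
          refine sum_le_sum fun r _ => ?_
          simp only [hA]
          split_ifs with h
          · simp; positivity
          · rw [sq]; exact mul_le_mul_of_nonneg_right (hmax r h) (norm_nonneg _)
      _ ≤ (2 * q * n ^ 3) * (q ^ 2 * n ^ 2) := by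
          rw [← mul_sum]; gcongr
      _ = _ := by ring
  have hA0 : ‖sh ψ E F 0‖ ≤ q ^ 2 * n ^ 2 :=
    (single_le_sum (f := fun r => ‖sh ψ E F r‖) (fun _ _ => norm_nonneg _) (mem_univ 0)).trans hsum
  have hpt : ∀ t ∈ univ.erase (0 : K), q ^ 4 * (nu E F t : ℝ) ^ 2
      ≤ 3 * (q ^ 2 * (n ^ 4) ^ 2 + (q ^ 2 * n ^ 2) ^ 2 + ‖W t‖ ^ 2) := by
    intro t ht
    have h := congrArg norm (nu_formula hK ψ hψ κ hκ E F (mem_erase.1 ht).1)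
    rw [norm_mul, norm_mul, hκn] at h
    simp only [Complex.norm_natCast] at h
    rw [← hq] at h
    have h2 : q * q * (nu E F t : ℝ) ≤ q * n ^ 4 + q ^ 2 * n ^ 2 + ‖W t‖ := by
      rw [h]
      refine (norm_add_le _ _).trans (add_le_add ((norm_sub_le _ _).trans (add_le_add ?_ hA0)) le_rfl)
      rw [norm_mul, hκn, hN]; simp
    calc _ = (q * q * (nu E F t : ℝ)) ^ 2 := by ring
      _ ≤ (q * n ^ 4 + q ^ 2 * n ^ 2 + ‖W t‖) ^ 2 := pow_le_pow_left₀ (by positivity) h2 2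
      _ ≤ _ := by
        nlinarith [sq_nonneg (q * n ^ 4 - q ^ 2 * n ^ 2), sq_nonneg (q * n ^ 4 - ‖W t‖),
          sq_nonneg (q ^ 2 * n ^ 2 - ‖W t‖)]
  have htot : q ^ 4 * ∑ t ∈ univ.erase (0 : K), (nu E F t : ℝ) ^ 2
      ≤ 3 * (q * (q ^ 2 * (n ^ 4) ^ 2 + (q ^ 2 * n ^ 2) ^ 2) + q ^ 2 * (2 * q ^ 3 * n ^ 5)) := by
    rw [mul_sum]
    calc _ ≤ _ := sum_le_sum hpt
      _ ≤ ∑ t : K, 3 * (q ^ 2 * (n ^ 4) ^ 2 + (q ^ 2 * n ^ 2) ^ 2 + ‖W t‖ ^ 2) :=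
        sum_le_sum_of_subset_of_nonneg (subset_univ _) fun _ _ _ => by positivity
      _ = 3 * (q * (q ^ 2 * (n ^ 4) ^ 2 + (q ^ 2 * n ^ 2) ^ 2) + ∑ t, ‖W t‖ ^ 2) := by
        rw [← mul_sum, sum_add_distrib, sum_const, card_univ, nsmul_eq_mul, ← hq]
      _ ≤ _ := by
        gcongr; refine hW.trans ?_; gcongr
  have hn1 : 1 ≤ n := by
    by_contra h
    have : n ^ 3 < 1 := pow_lt_one₀ hn (not_le.1 h) (by norm_num)
    nlinarith
  have i1 : q ^ 5 * n ^ 5 ≤ q ^ 3 * n ^ 8 := by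
    have := mul_le_mul_of_nonneg_left hbig (show 0 ≤ q ^ 3 * n ^ 5 by positivity)
    nlinarith
  have i2 : q ^ 5 * n ^ 4 ≤ q ^ 5 * n ^ 5 := by
    gcongr; norm_num
  have hq3 : 0 < q ^ 3 := by positivity
  refine le_of_mul_le_mul_left ?_ hq3
  calc _ = q ^ 4 * ∑ t ∈ univ.erase (0 : K), (nu E F t : ℝ) ^ 2 := by ring
    _ ≤ _ := htot
    _ ≤ _ := by nlinarith

lemma final (hK : ringChar K ≠ 2) (E F : Finset (K × K))
    (h : 16 * (Fintype.card K : ℝ) ^ ((8 : ℝ) / 3) ≤ (#E : ℝ) * #F) :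
    (1 / 48 : ℝ) * Fintype.card K ≤ #((E ×ˢ F).image fun p => nm (p.1 - p.2)) := by
  set q : ℝ := (Fintype.card K : ℝ) with hq
  have hq1 : 1 ≤ q := by
    rw [hq]; exact_mod_cast Fintype.card_pos
  set N : ℝ := (#E : ℝ) * #F with hNd
  have hN0 : 0 ≤ N := by positivity
  set n : ℝ := N ^ ((1 : ℝ) / 4) with hnd
  have hn0 : 0 ≤ n := by positivity
  have hn4 : n ^ 4 = N := by
    rw [hnd, ← Real.rpow_natCast, ← Real.rpow_mul hN0]; norm_num
  have hqp : (q ^ ((8 : ℝ) / 3)) ^ 3 = q ^ 8 := by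
    rw [← Real.rpow_natCast, ← Real.rpow_mul (by positivity), ← Real.rpow_natCast]; norm_num
  have hp0 : 0 ≤ q ^ ((8 : ℝ) / 3) := by positivity
  have hbig : q ^ 2 ≤ n ^ 3 := by
    refine le_of_pow_le_pow_left₀ (n := 4) (by norm_num) (by positivity) ?_
    calc (q ^ 2) ^ 4 = (q ^ ((8 : ℝ) / 3)) ^ 3 := by rw [hqp]; ring
      _ ≤ N ^ 3 := by gcongr; linarith
      _ = _ := by rw [← hn4]; ring
  have hq2 : 16 * q ^ 2 ≤ N := by
    refine le_trans ?_ h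
    gcongr
    rw [← Real.rpow_natCast]
    exact Real.rpow_le_rpow_of_exponent_le hq1 (by norm_num)
  have hNpos : 0 < N := by nlinarith
  have hm := main_bd hK E F n hn0 (by rw [hn4]) hbig
  rw [hn4, ← hq] at hm
  have hiso := iso_count E F
  rw [← hq] at hiso
  have hnu0 : (nu E F 0 : ℝ) ≤ N / 2 := by
    refine le_of_sq_le_sq ?_ (by positivity)
    have : (nu E F 0 : ℝ) ^ 2 ≤ (2 * q * #E) * (2 * q * #F) := by
      rw [sq]; exact mul_le_mul hiso.1 hiso.2 (by positivity) (by positivity)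
    nlinarith
  set D := (E ×ˢ F).image fun p => nm (p.1 - p.2) with hD
  have hall : ∑ t, (nu E F t : ℝ) = N := by
    have := card_eq_sum_card_fiberwise (s := E ×ˢ F) (f := fun p => nm (p.1 - p.2))
      (t := (univ : Finset K)) (fun _ _ => by simp)
    rw [card_product] at this
    rw [hNd]
    simp only [nu]
    exact_mod_cast this.symm
  have hlow : N / 2 ≤ ∑ t ∈ univ.erase (0 : K), (nu E F t : ℝ) := by
    rw [← add_sum_erase univ _ (mem_univ (0 : K))] at hall
    linarith
  have hsupp : ∑ t ∈ univ.erase (0 : K), (nu E F t : ℝ) = ∑ t ∈ D.erase 0, (nu E F t : ℝ) := by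
    symm
    refine sum_subset (erase_subset_erase _ (subset_univ _)) fun t ht ht' => ?_
    have : t ∉ D := fun h' => ht' (mem_erase.2 ⟨(mem_erase.1 ht).1, h'⟩)
    rw [Nat.cast_eq_zero, nu, card_eq_zero, filter_eq_empty_iff]
    intro p hp hpt
    exact this (mem_image.2 ⟨p, hp, hpt⟩)
  have hcs : (∑ t ∈ D.erase 0, (nu E F t : ℝ)) ^ 2
      ≤ #(D.erase 0) * ∑ t ∈ D.erase 0, (nu E F t : ℝ) ^ 2 := sq_sum_le_card_mul_sum_sq
  have hle : ∑ t ∈ D.erase 0, (nu E F t : ℝ) ^ 2 ≤ ∑ t ∈ univ.erase (0 : K), (nu E F t : ℝ) ^ 2 :=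
    sum_le_sum_of_subset_of_nonneg (erase_subset_erase _ (subset_univ _))
      fun _ _ _ => by positivity
  have hcard : (#(D.erase 0) : ℝ) ≤ #D := by exact_mod_cast card_erase_le
  rw [hsupp] at hlow
  have h1 : (N / 2) ^ 2 ≤ #D * ∑ t ∈ univ.erase (0 : K), (nu E F t : ℝ) ^ 2 :=
    (pow_le_pow_left₀ (by positivity) hlow 2).trans (hcs.trans (by gcongr))
  have h2 : q * (N / 2) ^ 2 ≤ #D * (12 * N ^ 2) := by
    calc _ ≤ q * (#D * ∑ t ∈ univ.erase (0 : K), (nu E F t : ℝ) ^ 2) := by gcongr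
      _ = #D * (q * ∑ t ∈ univ.erase (0 : K), (nu E F t : ℝ) ^ 2) := by ring
      _ ≤ _ := by gcongr
  have hN2 : 0 < N ^ 2 := by positivity
  refine le_of_mul_le_mul_right ?_ hN2
  nlinarith

end

/-- Koh–Shen: for `P(x) = x₁² + x₂²` there are absolute constants
`C, c > 0` such that for every finite field of odd characteristic and all
`E, F ⊆ F_q²` with `|E||F| ≥ C q^{8/3}`, `|Δ_P(E,F)| ≥ c q`. -/
theorem stmt19 :
    ∃ C : ℝ, 0 < C ∧ ∃ c : ℝ, 0 < c ∧
      ∀ (K : Type) [Field K] [Fintype K] [DecidableEq K],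
        ringChar K ≠ 2 →
        ∀ E F : Finset (Fin 2 → K),
          C * (Fintype.card K : ℝ) ^ ((8 : ℝ) / 3) ≤ (E.card : ℝ) * (F.card : ℝ) →
          c * (Fintype.card K : ℝ) ≤
            (((E ×ˢ F).image
              (fun p => ∑ j, (p.1 j - p.2 j) ^ 2)).card : ℝ) := by
  refine ⟨16, by norm_num, 1 / 48, by norm_num, ?_⟩
  intro K _ _ _ hK E F h
  have := final hK (E.map (finTwoArrowEquiv K).toEmbedding) (F.map (finTwoArrowEquiv K).toEmbedding)
    (by simpa using h)
  refine this.trans_eq ?_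
  congr 2
  ext t
  simp only [mem_image, mem_product, mem_map, Fin.sum_univ_two, nm]
  constructor
  · rintro ⟨⟨a, b⟩, ⟨⟨x, hx, hxa⟩, ⟨y, hy, hyb⟩⟩, rfl⟩
    simp only at hxa hyb
    subst hxa hyb
    exact ⟨(x, y), ⟨hx, hy⟩, by simp⟩
  · rintro ⟨⟨x, y⟩, ⟨hx, hy⟩, rfl⟩
    exact ⟨(finTwoArrowEquiv K x, finTwoArrowEquiv K y), ⟨⟨x, hx, rfl⟩, ⟨y, hy, rfl⟩⟩, by simp⟩
end
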